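/- Suppose g is not of type A_{2p}. Let Δ⟨K⟩ = Δ(a_K) = w_K(Δ⁺_{x_K}(-1)) ∪ w_K(-Δ⁺_{x_K}(2)) be the set of roots of the abelian ideal a_K. Then the set of maximal elements of the complement Δ⁺ \ Δ⟨K⟩ with respect to the root order ≼ is exactly -w_K(Π_K(1)); equivalently, γ ∈ max(Δ⁺ \ Δ⟨K⟩) if and only if -w_K^{-1}(γ) ∈ Π_K(1). -/

import Mathlib

open scoped RealInnerProductSpace

attribute [local instance] Classical.propDecidable

section RootCombinatorics

variable {V : Type*} [NormedAddCommGroup V] [InnerProductSpace ℝ V]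

/-- The Cartan pairing `⟨γ, α∨⟩ = 2 (γ, α) / (α, α)`. -/
noncomputable def cartanPairing (γ α : V) : ℝ := 2 * ⟪γ, α⟫ / ⟪α, α⟫

/-- The coroot `γ∨ = 2 γ / (γ, γ)`. -/
noncomputable def covec (γ : V) : V := (2 / ⟪γ, γ⟫) • γ

/-- The cascade element `x_K = Σ_{β ∈ K} β / (β, β) = ½ Σ_{β ∈ K} β∨`. -/
noncomputable def cascElt (K : Finset V) : V := ∑ β ∈ K, (⟪β, β⟫)⁻¹ • β

/-- The roots of `S` orthogonal to `β`. -/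
noncomputable def orthSub (S : Finset V) (β : V) : Finset V := S.filter fun γ => ⟪γ, β⟫ = 0

/-- One step of the non-orthogonality (connectedness) relation inside `S`. -/
def connRel (S : Finset V) (a b : V) : Prop := a ∈ S ∧ b ∈ S ∧ ⟪a, b⟫ ≠ 0

/-- The irreducible component of the root subsystem `S` containing `γ`. -/
noncomputable def component (S : Finset V) (γ : V) : Finset V :=
  S.filter fun γ' => Relation.ReflTransGen (connRel S) γ γ'

/-- `C` is an irreducible component of the root subsystem `S`. -/
def IsComponent (S C : Finset V) : Prop := ∃ γ ∈ S, C = component S γ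

end RootCombinatorics

/-- The combinatorial data of an irreducible crystallographic root system with a chosen
system of positive roots, base (set of simple roots) and highest root: the combinatorial
skeleton of a finite-dimensional complex simple Lie algebra, with the Killing-form
identification of the Cartan subalgebra and its dual. -/
structure RootSystemCtx (V : Type*) [NormedAddCommGroup V] [InnerProductSpace ℝ V] where
  /-- the set of roots Δ -/
  Δ : Finset V
  /-- the set of simple roots Π -/
  base : Finset V
  /-- the set of positive roots Δ⁺ -/
  Pos : Finset V
  /-- the highest root θ -/
  θ : V
  zero_not_mem : (0 : V) ∉ Δ
  neg_mem : ∀ γ ∈ Δ, -γ ∈ Δ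
  reflect_mem : ∀ α ∈ Δ, ∀ γ ∈ Δ, γ - cartanPairing γ α • α ∈ Δ
  pairing_int : ∀ α ∈ Δ, ∀ γ ∈ Δ, ∃ k : ℤ, cartanPairing γ α = (k : ℝ)
  span_eq : Submodule.span ℝ (Δ : Set V) = ⊤
  base_subset : base ⊆ Pos
  base_indep : LinearIndependent ℝ (fun a : {x // x ∈ base} => (a : V))
  pos_subset : Pos ⊆ Δ
  pos_or_neg : ∀ γ ∈ Δ, γ ∈ Pos ∨ -γ ∈ Pos
  pos_not_neg : ∀ γ ∈ Pos, -γ ∉ Pos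
  pos_coords : ∀ γ ∈ Pos, γ ∈ AddSubmonoid.closure (base : Set V)
  irreducible : ∀ S : Finset V, S ⊆ Δ → S.Nonempty →
    (∀ a ∈ S, ∀ b ∈ Δ, b ∉ S → ⟪a, b⟫ = 0) → S = Δ
  theta_mem : θ ∈ Pos
  theta_highest : ∀ γ ∈ Δ, θ - γ ∈ AddSubmonoid.closure (base : Set V)

namespace RootSystemCtx

variable {V : Type*} [NormedAddCommGroup V] [InnerProductSpace ℝ V]

variable (ctx : RootSystemCtx V)

/-- The root order `γ ≼ γ'` on roots: `γ' - γ` is a nonnegative integral combination of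
simple roots. -/
def rootLE (γ γ' : V) : Prop := γ' - γ ∈ AddSubmonoid.closure (ctx.base : Set V)

/-- `β` is the highest root of the root subsystem `S` (with respect to the ambient positive
system). -/
def IsHighest (S : Finset V) (β : V) : Prop :=
  β ∈ S ∧ β ∈ ctx.Pos ∧ ∀ γ ∈ S, ctx.rootLE γ β

/-- `CascadeMem ctx S β` : the pair (root subsystem `S = Δ⟨i⟩`, its highest root `β = βᵢ`)
occurs in the recursive construction of the Kostant cascade: one starts with `(Δ, θ)`, and the
descendants of `(S, β)` are the pairs `(C, β')` where `C` is an irreducible component of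
`{γ ∈ S | (γ, β) = 0}` and `β'` is the highest root of `C`. -/
inductive CascadeMem : Finset V → V → Prop
  | top : CascadeMem ctx.Δ ctx.θ
  | step {S C : Finset V} {β β' : V} : CascadeMem S β →
      IsComponent (orthSub S β) C → ctx.IsHighest C β' → CascadeMem C β'

/-- `K` is the Kostant cascade of the root system. -/
def IsCascade (K : Finset V) : Prop := ∀ β, β ∈ K ↔ ∃ S, ctx.CascadeMem S β

/-- The Heisenberg subset `H_β = {γ ∈ S ∩ Δ⁺ : (γ, β) > 0}` attached to a cascade pair
`(S, β)`. -/
noncomputable def heis (S : Finset V) (β : V) : Finset V :=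
  S.filter fun γ => γ ∈ ctx.Pos ∧ 0 < ⟪γ, β⟫

/-- A root is long if it has the same length as the highest root. -/
def IsLong (γ : V) : Prop := ⟪γ, γ⟫ = ⟪ctx.θ, ctx.θ⟫

/-- The highest root `θ` is a fundamental weight. -/
def ThetaFundamental : Prop :=
  ∃ α ∈ ctx.base, cartanPairing ctx.θ α = 1 ∧
    ∀ β ∈ ctx.base, β ≠ α → cartanPairing ctx.θ β = 0

/-- `β'` is a descendant of the cascade element `β`. -/
def Desc (β β' : V) : Prop :=
  ∃ S C, ctx.CascadeMem S β ∧ IsComponent (orthSub S β) C ∧ ctx.IsHighest C β'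

/-- The cascade poset order: `β ≤ β'` iff `β` is an iterated descendant of `β'`. -/
def cascLE (β β' : V) : Prop := Relation.ReflTransGen (fun a b => ctx.Desc b a) β β'

/-- A simple reflection of the root system. -/
def IsSimpleReflection (w : V ≃ₗ[ℝ] V) : Prop :=
  ∃ α ∈ ctx.base, ∀ v, w v = v - (2 * ⟪v, α⟫ / ⟪α, α⟫) • α

/-- The Weyl group, generated by the simple reflections. -/
def weylGroup : Subgroup (V ≃ₗ[ℝ] V) := Subgroup.closure {w | ctx.IsSimpleReflection w}

/-- The length of a Weyl group element: the minimal number of simple reflections needed to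
express it. -/
noncomputable def length (w : V ≃ₗ[ℝ] V) : ℕ :=
  sInf {n | ∃ l : List (V ≃ₗ[ℝ] V), l.length = n ∧
    (∀ s ∈ l, ctx.IsSimpleReflection s) ∧ l.prod = w}

/-- The root system is of type `Aₙ` (Cartan matrix characterisation). -/
def IsTypeA (n : ℕ) : Prop :=
  1 ≤ n ∧ ∃ e : Fin n ≃ {x // x ∈ ctx.base}, ∀ i j : Fin n,
    cartanPairing (e i : V) (e j : V) =
      (if i = j then 2 else if i.val + 1 = j.val ∨ j.val + 1 = i.val then -1 else 0)

/-- The root system is of type `Bₙ` (`n ≥ 2`), with the last simple root short. -/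
def IsTypeB (n : ℕ) : Prop :=
  2 ≤ n ∧ ∃ e : Fin n ≃ {x // x ∈ ctx.base}, ∀ i j : Fin n,
    cartanPairing (e i : V) (e j : V) =
      (if i = j then 2
       else if i.val + 2 = n ∧ j.val + 1 = n then -2
       else if i.val + 1 = j.val ∨ j.val + 1 = i.val then -1 else 0)

/-- The root system is of type `Cₙ` (`n ≥ 2`), with the last simple root long. -/
def IsTypeC (n : ℕ) : Prop :=
  2 ≤ n ∧ ∃ e : Fin n ≃ {x // x ∈ ctx.base}, ∀ i j : Fin n,
    cartanPairing (e i : V) (e j : V) =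
      (if i = j then 2
       else if i.val + 1 = n ∧ j.val + 2 = n then -2
       else if i.val + 1 = j.val ∨ j.val + 1 = i.val then -1 else 0)

/-- The root system is of type `G₂` (first simple root short). -/
def IsTypeG2 : Prop :=
  ∃ e : Fin 2 ≃ {x // x ∈ ctx.base},
    cartanPairing (e 0 : V) (e 0 : V) = 2 ∧ cartanPairing (e 1 : V) (e 1 : V) = 2 ∧
    cartanPairing (e 0 : V) (e 1 : V) = -1 ∧ cartanPairing (e 1 : V) (e 0 : V) = -3

/-- The set of roots `Δ(a_z) = w(Δ⁺_z(-1)) ∪ w(-Δ⁺_z(2))` of the abelian ideal attached by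
Kostant's construction to `z` (with `w = w_z`). -/
def idealSet (w : V ≃ₗ[ℝ] V) (x : V) : Set V :=
  {δ | ∃ γ ∈ ctx.Pos, (⟪γ, x⟫ = -1 ∧ δ = w γ) ∨ (⟪γ, x⟫ = 2 ∧ δ = -(w γ))}

end RootSystemCtx

namespace RootSystemCtx

variable {V : Type*} [NormedAddCommGroup V] [InnerProductSpace ℝ V] (ctx : RootSystemCtx V)

/-- A subset of `Δ` which is stable under its own reflections. -/
def IsSubsystem (S : Finset V) : Prop :=
  S ⊆ ctx.Δ ∧ ∀ a ∈ S, ∀ b ∈ S, b - cartanPairing b a • a ∈ S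

theorem exists_height : ∃ ht : V →ₗ[ℝ] ℝ, ∀ α ∈ ctx.base, ht α = 1 := by
  obtain ⟨ht, h⟩ := LinearMap.exists_extend
    ((Module.Basis.span ctx.base_indep).constr ℝ (fun _ => (1 : ℝ)))
  refine ⟨ht, fun α hα => ?_⟩
  have h1 := (Module.Basis.span ctx.base_indep).constr_basis ℝ (fun _ => (1 : ℝ)) ⟨α, hα⟩
  rw [← h, LinearMap.comp_apply, Submodule.subtype_apply, Module.Basis.span_apply] at h1
  exact h1

/-- The height: the linear functional taking the value `1` on each simple root. -/
noncomputable def height : V →ₗ[ℝ] ℝ := ctx.exists_height.choose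

theorem height_base {α : V} (hα : α ∈ ctx.base) : ctx.height α = 1 :=
  ctx.exists_height.choose_spec α hα

theorem eq_zero_or_one_le_height {v : V} (hv : v ∈ AddSubmonoid.closure (ctx.base : Set V)) :
    v = 0 ∨ 1 ≤ ctx.height v := by
  induction hv using AddSubmonoid.closure_induction with
  | mem x hx => exact Or.inr (ctx.height_base hx).ge
  | zero => exact Or.inl rfl
  | add x y _ _ hx hy =>
    rcases hx with rfl | hx <;> rcases hy with rfl | hy
    · simp
    · exact Or.inr (by simpa using hy)
    · exact Or.inr (by simpa using hx)
    · exact Or.inr (by rw [map_add]; linarith)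

theorem ne_zero_of_mem {a : V} (ha : a ∈ ctx.Δ) : a ≠ 0 :=
  fun h => ctx.zero_not_mem (h ▸ ha)

theorem inner_self_pos_of_mem {a : V} (ha : a ∈ ctx.Δ) : 0 < ⟪a, a⟫ :=
  real_inner_self_pos.2 (ctx.ne_zero_of_mem ha)

theorem one_le_height {a : V} (ha : a ∈ ctx.Pos) : 1 ≤ ctx.height a :=
  (ctx.eq_zero_or_one_le_height (ctx.pos_coords a ha)).resolve_left
    (ctx.ne_zero_of_mem (ctx.pos_subset ha))

theorem height_nonneg {v : V} (hv : v ∈ AddSubmonoid.closure (ctx.base : Set V)) :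
    0 ≤ ctx.height v := by
  rcases ctx.eq_zero_or_one_le_height hv with rfl | h
  · simp
  · linarith

theorem eq_zero_of_height_le {v : V} (hv : v ∈ AddSubmonoid.closure (ctx.base : Set V))
    (h : ctx.height v ≤ 0) : v = 0 :=
  (ctx.eq_zero_or_one_le_height hv).resolve_right (by linarith)

theorem pos_of_height_pos {a : V} (ha : a ∈ ctx.Δ) (h : 0 < ctx.height a) : a ∈ ctx.Pos := by
  refine (ctx.pos_or_neg a ha).resolve_right fun hn => ?_
  have := ctx.one_le_height hn
  rw [map_neg] at this
  linarith

theorem pos_of_mem_closure {a : V} (ha : a ∈ ctx.Δ)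
    (h : a ∈ AddSubmonoid.closure (ctx.base : Set V)) : a ∈ ctx.Pos := by
  apply ctx.pos_of_height_pos ha
  have := (ctx.eq_zero_or_one_le_height h).resolve_left (ctx.ne_zero_of_mem ha)
  linarith

theorem rootLE_antisymm {a b : V} (hab : ctx.rootLE a b) (hba : ctx.rootLE b a) : a = b := by
  have h := ctx.height_nonneg hba
  rw [map_sub] at h
  exact (sub_eq_zero.1 (ctx.eq_zero_of_height_le hab (by rw [map_sub]; linarith))).symm

variable {ctx}

theorem IsHighest.unique {S : Finset V} {β β' : V} (h : ctx.IsHighest S β)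
    (h' : ctx.IsHighest S β') : β = β' :=
  ctx.rootLE_antisymm (h'.2.2 β h.1) (h.2.2 β' h'.1)

namespace IsSubsystem

variable {S : Finset V}

theorem neg_mem (hS : ctx.IsSubsystem S) {a : V} (ha : a ∈ S) : -a ∈ S := by
  have h := hS.2 a ha a ha
  have h0 := (ctx.inner_self_pos_of_mem (hS.1 ha)).ne'
  rw [cartanPairing, mul_div_assoc, div_self h0] at h
  convert h using 1
  module

theorem sub_mem (hS : ctx.IsSubsystem S) {a b : V} (ha : a ∈ S) (hb : b ∈ S)
    (hab : 0 < ⟪a, b⟫) : a = b ∨ a - b ∈ S := by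
  have hA := ctx.inner_self_pos_of_mem (hS.1 ha)
  have hB := ctx.inner_self_pos_of_mem (hS.1 hb)
  have hba : ⟪b, a⟫ = ⟪a, b⟫ := real_inner_comm _ _
  obtain ⟨n, hn⟩ := ctx.pairing_int b (hS.1 hb) a (hS.1 ha)
  obtain ⟨m, hm⟩ := ctx.pairing_int a (hS.1 ha) b (hS.1 hb)
  have hn0 : 0 < n := by
    have : (0 : ℝ) < n := by rw [← hn, cartanPairing]; positivity
    exact_mod_cast this
  have hm0 : 0 < m := by
    have : (0 : ℝ) < m := by rw [← hm, cartanPairing, hba]; positivity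
    exact_mod_cast this
  by_cases hn1 : n = 1
  · right
    have := hS.2 b hb a ha
    rwa [hn, hn1, Int.cast_one, one_smul] at this
  by_cases hm1 : m = 1
  · right
    have := hS.2 a ha b hb
    rw [hm, hm1, Int.cast_one, one_smul] at this
    simpa using hS.neg_mem this
  left
  have h1 : (2 : ℝ) ≤ n := by exact_mod_cast (by omega : 2 ≤ n)
  have h2 : (2 : ℝ) ≤ m := by exact_mod_cast (by omega : 2 ≤ m)
  rw [← hn, cartanPairing, le_div_iff₀ hB] at h1
  rw [← hm, cartanPairing, hba, le_div_iff₀ hA] at h2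
  have h3 : ⟪a - b, a - b⟫ ≤ 0 := by
    rw [inner_sub_left, inner_sub_right, inner_sub_right, hba]
    linarith
  exact sub_eq_zero.1 (inner_self_eq_zero.1 (h3.antisymm real_inner_self_nonneg))

theorem orthSub (hS : ctx.IsSubsystem S) (β : V) : ctx.IsSubsystem (orthSub S β) := by
  refine ⟨(Finset.filter_subset _ _).trans hS.1, fun a ha b hb => ?_⟩
  rw [_root_.orthSub, Finset.mem_filter] at *
  refine ⟨hS.2 a ha.1 b hb.1, ?_⟩
  rw [inner_sub_left, real_inner_smul_left, ha.2, hb.2]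
  ring

theorem component (hS : ctx.IsSubsystem S) (γ : V) : ctx.IsSubsystem (component S γ) := by
  refine ⟨(Finset.filter_subset _ _).trans hS.1, fun a ha b hb => ?_⟩
  by_cases h : ⟪b, a⟫ = 0
  · simpa [cartanPairing, h] using hb
  rw [_root_.component, Finset.mem_filter] at *
  have hab := hS.2 a ha.1 b hb.1
  refine ⟨hab, ha.2.tail ⟨ha.1, hab, ?_⟩⟩
  have h0 := (ctx.inner_self_pos_of_mem (hS.1 ha.1)).ne'
  rw [inner_sub_right, real_inner_smul_right, cartanPairing, div_mul_cancel₀ _ h0,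
    real_inner_comm]
  intro h'
  apply h
  rw [real_inner_comm] at h' ⊢
  linarith

/-- A root of maximal height among those above a given one is dominant. -/
theorem inner_nonneg_of_maximal (hS : ctx.IsSubsystem S) {M γ : V} (hM : M ∈ S)
    (hmax : ∀ μ ∈ S, ctx.rootLE M μ → μ = M) (hγ : γ ∈ S) (hγp : γ ∈ ctx.Pos) :
    0 ≤ ⟪M, γ⟫ := by
  by_contra! hneg
  rcases hS.sub_mem (a := M) (b := -γ) hM (hS.neg_mem hγ) (by rw [inner_neg_right]; linarith)
    with h | h
  · have h1 := hmax γ hγ (by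
      rw [rootLE, h, sub_neg_eq_add]
      exact add_mem (ctx.pos_coords γ hγp) (ctx.pos_coords γ hγp))
    rw [h1] at hneg
    exact absurd hneg (not_lt.2 real_inner_self_nonneg)
  · have h1 := hmax _ h (by
      rw [rootLE]
      convert ctx.pos_coords γ hγp using 1
      abel)
    apply ctx.ne_zero_of_mem (hS.1 hγ)
    simpa using h1

theorem exists_maximal_above (hS : ctx.IsSubsystem S) {γ : V} (hγ : γ ∈ S)
    (hγp : γ ∈ ctx.Pos) : ∃ M ∈ S, M ∈ ctx.Pos ∧ ctx.rootLE γ M ∧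
      ∀ μ ∈ S, ctx.rootLE M μ → μ = M := by
  obtain ⟨M, hM, hmax⟩ := Finset.exists_max_image (S.filter fun μ => ctx.rootLE γ μ) ctx.height
    ⟨γ, Finset.mem_filter.2 ⟨hγ, by simp [rootLE]⟩⟩
  rw [Finset.mem_filter] at hM
  refine ⟨M, hM.1, ?_, hM.2, fun μ hμ hle => ?_⟩
  · apply ctx.pos_of_height_pos (hS.1 hM.1)
    have h1 := ctx.height_nonneg hM.2
    have h2 := ctx.one_le_height hγp
    rw [map_sub] at h1
    linarith
  · have h1 := hmax μ (by
      rw [Finset.mem_filter]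
      refine ⟨hμ, ?_⟩
      have := add_mem hle hM.2
      rwa [sub_add_sub_cancel] at this)
    exact sub_eq_zero.1 (ctx.eq_zero_of_height_le hle (by rw [map_sub]; linarith))

/-- A root of the subsystem cannot pair nontrivially with two orthogonal maximal roots. -/
theorem inner_eq_zero_of_maximal (hS : ctx.IsSubsystem S) {M M' γ : V}
    (hM : M ∈ S) (hmax : ∀ μ ∈ S, ctx.rootLE M μ → μ = M)
    (hM' : M' ∈ S) (hmax' : ∀ μ ∈ S, ctx.rootLE M' μ → μ = M')
    (horth : ⟪M, M'⟫ = 0) (hγ : γ ∈ S) (hγM : ⟪γ, M⟫ ≠ 0) : ⟪γ, M'⟫ = 0 := by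
  wlog hp : γ ∈ ctx.Pos generalizing γ
  · have := this (γ := -γ) (hS.neg_mem hγ) (by simpa [inner_neg_left] using hγM)
      ((ctx.pos_or_neg γ (hS.1 hγ)).resolve_left hp)
    simpa [inner_neg_left] using this
  by_contra hγM'
  have h1 : 0 < ⟪M, γ⟫ := lt_of_le_of_ne (hS.inner_nonneg_of_maximal hM hmax hγ hp)
    (by rw [real_inner_comm]; exact hγM.symm)
  have h2 : 0 < ⟪M', γ⟫ := lt_of_le_of_ne (hS.inner_nonneg_of_maximal hM' hmax' hγ hp)
    (by rw [real_inner_comm]; exact fun h => hγM' h.symm)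
  rcases hS.sub_mem hM hγ h1 with h | h
  · exact hγM' (h ▸ horth)
  · have hpos : M - γ ∈ ctx.Pos := by
      refine (ctx.pos_or_neg _ (hS.1 h)).resolve_right fun hn => ?_
      have h3 := hmax γ hγ (by
        rw [rootLE]
        simpa using ctx.pos_coords _ hn)
      exact ctx.ne_zero_of_mem (hS.1 h) (by rw [h3, sub_self])
    have h3 := hS.inner_nonneg_of_maximal hM' hmax' h hpos
    rw [inner_sub_right, real_inner_comm M M', horth] at h3
    linarith

end IsSubsystem

theorem connRel_symm {S : Finset V} {a b : V} (h : connRel S a b) : connRel S b a :=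
  ⟨h.2.1, h.1, by rw [real_inner_comm]; exact h.2.2⟩

theorem reflTransGen_connRel_symm {S : Finset V} {a b : V}
    (h : Relation.ReflTransGen (connRel S) a b) : Relation.ReflTransGen (connRel S) b a := by
  induction h with
  | refl => exact .refl
  | tail _ h ih => exact .head (connRel_symm h) ih

/-- Two maximal roots of an irreducible component coincide. -/
theorem IsSubsystem.maximal_unique {S C : Finset V} (hS : ctx.IsSubsystem S)
    (hC : IsComponent S C) {M M' : V}
    (hM : M ∈ C) (hmax : ∀ μ ∈ C, ctx.rootLE M μ → μ = M)
    (hM' : M' ∈ C) (hpos' : M' ∈ ctx.Pos) (hmax' : ∀ μ ∈ C, ctx.rootLE M' μ → μ = M') :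
    M = M' := by
  obtain ⟨γ, hγ, rfl⟩ := hC
  have hCs := hS.component γ
  by_contra hne
  have horth : ⟪M, M'⟫ = 0 := by
    refine le_antisymm ?_ (hCs.inner_nonneg_of_maximal hM hmax hM' hpos')
    by_contra! hlt
    rcases hCs.sub_mem hM hM' hlt with h | h
    · exact hne h
    · rcases ctx.pos_or_neg _ (hCs.1 h) with hp | hp
      · exact hne (hmax' M hM (ctx.pos_coords _ hp))
      · refine hne (hmax M' hM' ?_).symm
        have := ctx.pos_coords _ hp
        rwa [neg_sub] at this
  set U := Submodule.span ℝ {a : V | a ∈ _root_.component S γ ∧ ⟪a, M⟫ ≠ 0} with hU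
  have hUM' : ∀ u ∈ U, ⟪u, M'⟫ = 0 := by
    intro u hu
    induction hu using Submodule.span_induction with
    | mem u hu => exact hCs.inner_eq_zero_of_maximal hM hmax hM' hmax' horth hu.1 hu.2
    | zero => exact inner_zero_left _
    | add x y _ _ hx hy => rw [inner_add_left, hx, hy, add_zero]
    | smul r x _ hx => rw [real_inner_smul_left, hx, mul_zero]
  have hMM : ⟪M, M⟫ ≠ 0 := (ctx.inner_self_pos_of_mem (hCs.1 hM)).ne'
  have hMpath := (Finset.mem_filter.1 hM).2
  have hM'path := (Finset.mem_filter.1 hM').2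
  have key : ∀ c, Relation.ReflTransGen (connRel S) M c →
      c ∈ _root_.component S γ ∧ c ∈ U := by
    intro c hc
    induction hc with
    | refl => exact ⟨hM, Submodule.subset_span ⟨hM, hMM⟩⟩
    | @tail b c _ hbc ih =>
      have hcC : c ∈ _root_.component S γ :=
        Finset.mem_filter.2 ⟨hbc.2.1, (Finset.mem_filter.1 ih.1).2.tail hbc⟩
      refine ⟨hcC, ?_⟩
      by_cases hcM : ⟪c, M⟫ = 0
      swap
      · exact Submodule.subset_span ⟨hcC, hcM⟩
      by_cases hall : ∀ a ∈ _root_.component S γ, ⟪a, M⟫ ≠ 0 → ⟪a, c⟫ = 0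
      · exfalso
        have : ∀ u ∈ U, ⟪u, c⟫ = 0 := by
          intro u hu
          induction hu using Submodule.span_induction with
          | mem u hu => exact hall u hu.1 hu.2
          | zero => exact inner_zero_left _
          | add x y _ _ hx hy => rw [inner_add_left, hx, hy, add_zero]
          | smul r x _ hx => rw [real_inner_smul_left, hx, mul_zero]
        exact hbc.2.2 (this b ih.2)
      · push Not at hall
        obtain ⟨a, haC, haM, hac⟩ := hall
        have ha0 := (ctx.inner_self_pos_of_mem (hCs.1 haC)).ne'
        have hk : cartanPairing c a ≠ 0 := by
          rw [cartanPairing, real_inner_comm]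
          exact div_ne_zero (mul_ne_zero two_ne_zero hac) ha0
        have h1 : c - cartanPairing c a • a ∈ U := by
          refine Submodule.subset_span ⟨hCs.2 a haC c hcC, ?_⟩
          rw [inner_sub_left, real_inner_smul_left, hcM, zero_sub]
          exact neg_ne_zero.2 (mul_ne_zero hk haM)
        have h2 : a ∈ U := Submodule.subset_span ⟨haC, haM⟩
        have := U.add_mem h1 (U.smul_mem (cartanPairing c a) h2)
        rwa [sub_add_cancel] at this
  have h := hUM' M' (key M' ((reflTransGen_connRel_symm hMpath).trans hM'path)).2
  exact (ctx.inner_self_pos_of_mem (hCs.1 hM')).ne' h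

theorem IsSubsystem.exists_highest {S C : Finset V} (hS : ctx.IsSubsystem S)
    (hC : IsComponent S C) : ∃ β, ctx.IsHighest C β := by
  have hCs : ctx.IsSubsystem C := by
    obtain ⟨γ, -, rfl⟩ := hC
    exact hS.component γ
  have hne : ∃ γ ∈ C, γ ∈ ctx.Pos := by
    obtain ⟨γ, hγ, rfl⟩ := hC
    have hγC : γ ∈ _root_.component S γ := Finset.mem_filter.2 ⟨hγ, .refl⟩
    rcases ctx.pos_or_neg γ (hS.1 hγ) with h | h
    · exact ⟨γ, hγC, h⟩
    · exact ⟨-γ, hCs.neg_mem hγC, h⟩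
  obtain ⟨γ, hγ, hγp⟩ := hne
  obtain ⟨M, hM, hMp, -, hmax⟩ := hCs.exists_maximal_above hγ hγp
  have hpos : ∀ μ ∈ C, μ ∈ ctx.Pos → ctx.rootLE μ M := by
    intro μ hμ hμp
    obtain ⟨M', hM', hMp', hle, hmax'⟩ := hCs.exists_maximal_above hμ hμp
    rwa [hS.maximal_unique hC hM hmax hM' hMp' hmax']
  refine ⟨M, hM, hMp, fun μ hμ => ?_⟩
  rcases ctx.pos_or_neg μ (hCs.1 hμ) with h | h
  · exact hpos μ hμ h
  · rw [rootLE, sub_eq_add_neg]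
    exact add_mem (ctx.pos_coords M hMp) (ctx.pos_coords _ h)

theorem isSubsystem_roots : ctx.IsSubsystem ctx.Δ := ⟨subset_rfl, ctx.reflect_mem⟩

theorem CascadeMem.isSubsystem {S : Finset V} {β : V} (h : ctx.CascadeMem S β) :
    ctx.IsSubsystem S := by
  induction h with
  | top => exact isSubsystem_roots
  | step _ hC _ ih =>
    obtain ⟨γ, -, rfl⟩ := hC
    exact (ih.orthSub _).component γ

theorem CascadeMem.isHighest {S : Finset V} {β : V} (h : ctx.CascadeMem S β) :
    ctx.IsHighest S β := by
  cases h with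
  | top => exact ⟨ctx.pos_subset ctx.theta_mem, ctx.theta_mem, ctx.theta_highest⟩
  | step _ _ h => exact h

theorem IsHighest.sub_pos {S : Finset V} {β γ : V} (hS : ctx.IsSubsystem S)
    (h : ctx.IsHighest S β) (hγ : γ ∈ S) (hγp : γ ∈ ctx.Pos) (hne : ⟪γ, β⟫ ≠ 0) :
    γ = β ∨ β - γ ∈ ctx.Pos := by
  have h1 : 0 ≤ ⟪β, γ⟫ := hS.inner_nonneg_of_maximal h.1
    (fun μ hμ hle => ctx.rootLE_antisymm (h.2.2 μ hμ) hle) hγ hγp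
  have h2 : 0 < ⟪β, γ⟫ := lt_of_le_of_ne h1 (by rw [real_inner_comm]; exact hne.symm)
  rcases hS.sub_mem h.1 hγ h2 with h3 | h3
  · exact Or.inl h3.symm
  · exact Or.inr (ctx.pos_of_mem_closure (hS.1 h3) (h.2.2 γ hγ))

/-- Every positive root lies in the Heisenberg subset of some cascade element. -/
theorem CascadeMem.exists_sub_pos {S : Finset V} {β : V} (h : ctx.CascadeMem S β) {γ : V}
    (hγ : γ ∈ S) (hγp : γ ∈ ctx.Pos) :
    ∃ S' β', ctx.CascadeMem S' β' ∧ (γ = β' ∨ β' - γ ∈ ctx.Pos) := by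
  induction hn : S.card using Nat.strong_induction_on generalizing S β with
  | _ n ih =>
    by_cases hne : ⟪γ, β⟫ = 0
    · have hγo : γ ∈ orthSub S β := Finset.mem_filter.2 ⟨hγ, hne⟩
      have hC : IsComponent (orthSub S β) (component (orthSub S β) γ) := ⟨γ, hγo, rfl⟩
      obtain ⟨β', hβ'⟩ := (h.isSubsystem.orthSub β).exists_highest hC
      refine ih _ ?_ (h.step hC hβ') (Finset.mem_filter.2 ⟨hγo, .refl⟩) rfl
      rw [← hn]
      refine Finset.card_lt_card ((Finset.filter_subset _ _).trans_ssubset ?_)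
      refine Finset.filter_ssubset.2 ⟨β, h.isHighest.1, ?_⟩
      exact (ctx.inner_self_pos_of_mem (h.isSubsystem.1 h.isHighest.1)).ne'
    · exact ⟨S, β, h, h.isHighest.sub_pos h.isSubsystem hγ hγp hne⟩

theorem subset_of_mem_component {S T C D : Finset V} (hC : IsComponent S C)
    (hD : IsComponent T D) (hCT : C ⊆ T) {c : V} (hcC : c ∈ C) (hcD : c ∈ D) : C ⊆ D := by
  obtain ⟨γ, hγ, rfl⟩ := hC
  obtain ⟨η, hη, rfl⟩ := hD
  intro a ha
  have hca := (reflTransGen_connRel_symm (Finset.mem_filter.1 hcC).2).trans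
    (Finset.mem_filter.1 ha).2
  clear ha
  suffices a ∈ component S γ ∧ a ∈ component T η from this.2
  induction hca with
  | refl => exact ⟨hcC, hcD⟩
  | @tail b a _ hba ih =>
    have haC : a ∈ component S γ :=
      Finset.mem_filter.2 ⟨hba.2.1, (Finset.mem_filter.1 ih.1).2.tail hba⟩
    have hbD := Finset.mem_filter.1 ih.2
    exact ⟨haC, Finset.mem_filter.2 ⟨hCT haC, hbD.2.tail ⟨hbD.1, hCT haC, hba.2.2⟩⟩⟩

theorem IsComponent.subset {S C : Finset V} (h : IsComponent S C) : C ⊆ S := by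
  obtain ⟨γ, -, rfl⟩ := h
  exact Finset.filter_subset _ _

theorem IsComponent.subset_of_orthSub {S C : Finset V} {β : V}
    (h : IsComponent (orthSub S β) C) : C ⊆ S :=
  (IsComponent.subset h).trans (Finset.filter_subset _ _)

theorem IsComponent.mem_of_inner_ne_zero {S C : Finset V} (h : IsComponent S C) {a b : V}
    (ha : a ∈ C) (hb : b ∈ S) (hab : ⟪a, b⟫ ≠ 0) : b ∈ C := by
  obtain ⟨γ, -, rfl⟩ := h
  have ha' := Finset.mem_filter.1 ha
  exact Finset.mem_filter.2 ⟨hb, ha'.2.tail ⟨ha'.1, hb, hab⟩⟩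

/-- Any two cascade pairs coincide, are nested, or are orthogonal. -/
theorem CascadeMem.trichotomy {S S' : Finset V} {β β' : V} (h : ctx.CascadeMem S β)
    (h' : ctx.CascadeMem S' β') :
    (S = S' ∧ β = β') ∨ S ⊆ orthSub S' β' ∨ S' ⊆ orthSub S β ∨
      ∀ a ∈ S, ∀ b ∈ S', ⟪a, b⟫ = 0 := by
  induction h generalizing S' β' with
  | top =>
    induction h' with
    | top => exact Or.inl ⟨rfl, rfl⟩
    | @step S C β β' hS hC _ ih =>
      refine Or.inr (Or.inr (Or.inl ?_))
      rcases ih with ⟨rfl, rfl⟩ | ih | ih | ih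
      · exact IsComponent.subset hC
      · have := Finset.mem_filter.1 (ih (hS.isSubsystem.1 hS.isHighest.1))
        exact absurd this.2
          (ctx.inner_self_pos_of_mem (hS.isSubsystem.1 hS.isHighest.1)).ne'
      · exact (IsComponent.subset_of_orthSub hC).trans ih
      · have hβ := hS.isHighest.1
        exact absurd (ih β (hS.isSubsystem.1 hβ) β hβ)
          (ctx.inner_self_pos_of_mem (hS.isSubsystem.1 hβ)).ne'
  | @step S C β γ hS hC hγ ih =>
    have hCS := IsComponent.subset_of_orthSub hC
    induction h' with
    | top =>
      refine Or.inr (Or.inl ?_)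
      rcases ih .top with ⟨rfl, rfl⟩ | h | h | h
      · exact IsComponent.subset hC
      · exact hCS.trans h
      · have := Finset.mem_filter.1 (h (hS.isSubsystem.1 hS.isHighest.1))
        exact absurd this.2
          (ctx.inner_self_pos_of_mem (hS.isSubsystem.1 hS.isHighest.1)).ne'
      · have hβ := hS.isHighest.1
        exact absurd (h β hβ β (hS.isSubsystem.1 hβ))
          (ctx.inner_self_pos_of_mem (hS.isSubsystem.1 hβ)).ne'
    | @step S' D β' γ' hS' hD hγ' ih' =>
      have hDS := IsComponent.subset_of_orthSub hD
      rcases ih' with ⟨rfl, rfl⟩ | h | h | h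
      · exact Or.inr (Or.inr (Or.inl (IsComponent.subset hD)))
      · rcases ih (hS'.step hD hγ') with ⟨rfl, rfl⟩ | h2 | h2 | h2
        · exact Or.inr (Or.inl (IsComponent.subset hC))
        · exact Or.inr (Or.inl (hCS.trans h2))
        · by_cases horth : ∀ a ∈ C, ∀ b ∈ D, ⟪a, b⟫ = 0
          · exact Or.inr (Or.inr (Or.inr horth))
          push Not at horth
          obtain ⟨c, hc, d, hd, hcd⟩ := horth
          have hdC := IsComponent.mem_of_inner_ne_zero hC hc (h2 hd) hcd
          have hCD : C = D := (subset_of_mem_component hC hD h hdC hd).antisymm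
            (subset_of_mem_component hD hC h2 hd hdC)
          subst hCD
          exact Or.inl ⟨rfl, hγ.unique hγ'⟩
        · exact Or.inr (Or.inr (Or.inr fun a ha b hb => h2 a (hCS ha) b hb))
      · exact Or.inr (Or.inr (Or.inl (hDS.trans h)))
      · exact Or.inr (Or.inr (Or.inr fun a ha b hb => h a ha b (hDS hb)))

theorem CascadeMem.inner_eq_zero {S S' : Finset V} {β β' : V} (h : ctx.CascadeMem S β)
    (h' : ctx.CascadeMem S' β') (hne : β ≠ β') : ⟪β, β'⟫ = 0 := by
  rcases h.trichotomy h' with h1 | h1 | h1 | h1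
  · exact absurd h1.2 hne
  · exact (Finset.mem_filter.1 (h1 h.isHighest.1)).2
  · rw [real_inner_comm]
    exact (Finset.mem_filter.1 (h1 h'.isHighest.1)).2
  · exact h1 _ h.isHighest.1 _ h'.isHighest.1

namespace IsCascade

variable {K : Finset V}

theorem mem_pos (hK : ctx.IsCascade K) {β : V} (hβ : β ∈ K) : β ∈ ctx.Pos := by
  obtain ⟨S, h⟩ := (hK β).1 hβ
  exact h.isHighest.2.1

theorem inner_eq_zero (hK : ctx.IsCascade K) {β β' : V} (hβ : β ∈ K) (hβ' : β' ∈ K)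
    (hne : β ≠ β') : ⟪β, β'⟫ = 0 := by
  obtain ⟨S, h⟩ := (hK β).1 hβ
  obtain ⟨S', h'⟩ := (hK β').1 hβ'
  exact h.inner_eq_zero h' hne

theorem exists_sub_pos (hK : ctx.IsCascade K) {γ : V} (hγ : γ ∈ ctx.Pos) :
    ∃ β ∈ K, γ = β ∨ β - γ ∈ ctx.Pos := by
  obtain ⟨S, β, h, h'⟩ := CascadeMem.top.exists_sub_pos (ctx.pos_subset hγ) hγ
  exact ⟨β, (hK β).2 ⟨S, h⟩, h'⟩

theorem inner_cascElt (hK : ctx.IsCascade K) {β : V} (hβ : β ∈ K) : ⟪β, cascElt K⟫ = 1 := by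
  rw [cascElt, inner_sum, Finset.sum_eq_single β]
  · rw [real_inner_smul_right]
    exact inv_mul_cancel₀ (ctx.inner_self_pos_of_mem (ctx.pos_subset (hK.mem_pos hβ))).ne'
  · intro b hb hne
    rw [real_inner_smul_right, hK.inner_eq_zero hβ hb hne.symm, mul_zero]
  · exact fun h => absurd hβ h

/-- No simple root takes the value `2` on the cascade element. -/
theorem inner_base_ne_two (hK : ctx.IsCascade K) {α : V} (hα : α ∈ ctx.base) :
    ⟪α, cascElt K⟫ ≠ 2 := by
  intro h2
  have hαΔ := ctx.pos_subset (ctx.base_subset hα)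
  have hA := ctx.inner_self_pos_of_mem hαΔ
  have hB : ∀ β ∈ K, 0 < ⟪β, β⟫ := fun β hβ =>
    ctx.inner_self_pos_of_mem (ctx.pos_subset (hK.mem_pos hβ))
  set c : V → ℝ := fun β => ⟪α, β⟫ / ⟪β, β⟫ with hc
  have hcB : ∀ β ∈ K, c β * ⟪β, β⟫ = ⟪α, β⟫ := fun β hβ => div_mul_cancel₀ _ (hB β hβ).ne'
  have hsum : ∑ β ∈ K, c β = 2 := by
    rw [← h2, cascElt, inner_sum]
    refine Finset.sum_congr rfl fun β _ => ?_
    rw [real_inner_smul_right, hc]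
    ring
  have hterm : ∀ β ∈ K, 0 ≤ 2 * (c β * ⟪α, β⟫) - c β * ⟪α, α⟫ := by
    intro β hβ
    have hβΔ := ctx.pos_subset (hK.mem_pos hβ)
    obtain ⟨n, hn⟩ := ctx.pairing_int β hβΔ α hαΔ
    obtain ⟨m, hm⟩ := ctx.pairing_int α hαΔ β hβΔ
    have hn' : 2 * c β = n := by rw [← hn, cartanPairing, hc]; ring
    have hm' : 2 * ⟪α, β⟫ = m * ⟪α, α⟫ := by
      rw [← hm, cartanPairing, div_mul_cancel₀ _ hA.ne', real_inner_comm]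
    have hnm : 2 * ⟪α, β⟫ = n * ⟪β, β⟫ := by rw [← hcB β hβ, ← hn']; ring
    have hle : n ≤ n * m := by
      rcases le_or_gt n 0 with h0 | h0
      · have : (m : ℝ) ≤ 0 := by
          have h0' : (n : ℝ) ≤ 0 := by exact_mod_cast h0
          have := hB β hβ
          by_contra! hlt
          nlinarith [mul_pos hlt hA]
        have : m ≤ 0 := by exact_mod_cast this
        nlinarith
      · have : (0 : ℝ) < m := by
          have h0' : (0 : ℝ) < n := by exact_mod_cast h0
          have := hB β hβ
          by_contra! hlt
          nlinarith [mul_pos h0' this]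
        have : 0 < m := by exact_mod_cast this
        nlinarith
    have hle' : (n : ℝ) ≤ n * m := by exact_mod_cast hle
    have : 2 * (2 * (c β * ⟪α, β⟫) - c β * ⟪α, α⟫) = (n * m - n) * ⟪α, α⟫ := by
      linear_combination (2 * ⟪α, β⟫ - ⟪α, α⟫) * hn' + n * hm'
    nlinarith [mul_nonneg (sub_nonneg.2 hle') hA.le]
  have hproj : ⟪α - ∑ β ∈ K, c β • β, α - ∑ β ∈ K, c β • β⟫ =
      ⟪α, α⟫ - ∑ β ∈ K, c β * ⟪α, β⟫ := by
    have h1 : ⟪α, ∑ β ∈ K, c β • β⟫ = ∑ β ∈ K, c β * ⟪α, β⟫ := by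
      simp_rw [inner_sum, real_inner_smul_right]
    have h3 : ⟪∑ β ∈ K, c β • β, ∑ β ∈ K, c β • β⟫ = ∑ β ∈ K, c β * ⟪α, β⟫ := by
      rw [sum_inner]
      refine Finset.sum_congr rfl fun β hβ => ?_
      rw [inner_sum, Finset.sum_eq_single β, real_inner_smul_left, real_inner_smul_right,
        hcB β hβ]
      · intro b hb hne
        rw [real_inner_smul_left, real_inner_smul_right, hK.inner_eq_zero hβ hb hne.symm]
        ring
      · exact fun h => absurd hβ h
    rw [inner_sub_left, inner_sub_right, inner_sub_right, h3,
      real_inner_comm α (∑ β ∈ K, c β • β), h1]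
    ring
  have htot : ∑ β ∈ K, (2 * (c β * ⟪α, β⟫) - c β * ⟪α, α⟫) =
      2 * (∑ β ∈ K, c β * ⟪α, β⟫) - 2 * ⟪α, α⟫ := by
    rw [Finset.sum_sub_distrib, ← Finset.mul_sum, ← Finset.sum_mul, hsum]
  have hp0 : 0 ≤ ⟪α - ∑ β ∈ K, c β • β, α - ∑ β ∈ K, c β • β⟫ := real_inner_self_nonneg
  have ht0 := Finset.sum_nonneg hterm
  have hpz : α - ∑ β ∈ K, c β • β = 0 := (inner_self_eq_zero (𝕜 := ℝ)).1 (by linarith)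
  have htz := (Finset.sum_eq_zero_iff_of_nonneg hterm).1 (by linarith)
  have hc0 : ∀ β ∈ K, 0 ≤ c β := by
    intro β hβ
    by_contra! hneg
    have h1 := htz β hβ
    rw [← hcB β hβ] at h1
    nlinarith [hB β hβ, mul_pos (neg_pos.2 hneg) hA,
      mul_pos (mul_pos (neg_pos.2 hneg) (neg_pos.2 hneg)) (hB β hβ)]
  have hht : ctx.height α = ∑ β ∈ K, c β * ctx.height β := by
    rw [sub_eq_zero.1 hpz, map_sum]
    simp
  have hge : ∑ β ∈ K, c β ≤ ∑ β ∈ K, c β * ctx.height β :=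
    Finset.sum_le_sum fun β hβ =>
      le_mul_of_one_le_right (hc0 β hβ) (ctx.one_le_height (hK.mem_pos hβ))
  rw [← hht, ctx.height_base hα, hsum] at hge
  norm_num at hge

end IsCascade

open scoped Pointwise in
/-- The Weyl group preserves the set of roots. -/
theorem weylGroup_map_mem {w : V ≃ₗ[ℝ] V} (hw : w ∈ ctx.weylGroup) :
    ∀ γ ∈ ctx.Δ, w γ ∈ ctx.Δ := by
  have hle : ctx.weylGroup ≤ MulAction.stabilizer (V ≃ₗ[ℝ] V) (ctx.Δ : Set V) := by
    rw [weylGroup, Subgroup.closure_le]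
    rintro s ⟨α, hα, hs⟩
    rw [SetLike.mem_coe, MulAction.mem_stabilizer_set_iff_smul_set_subset ctx.Δ.finite_toSet]
    rintro _ ⟨γ, hγ, rfl⟩
    change s γ ∈ ctx.Δ
    rw [hs]
    exact ctx.reflect_mem α (ctx.pos_subset (ctx.base_subset hα)) γ hγ
  intro γ hγ
  have := (MulAction.mem_stabilizer_set.1 (hle hw) γ).2 hγ
  exact this

theorem exists_sub_base_pos {a : V} (ha : a ∈ ctx.Pos) (hb : a ∉ ctx.base) :
    ∃ ν ∈ ctx.base, a - ν ∈ ctx.Pos := by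
  have hex : ∃ ν ∈ ctx.base, 0 < ⟪a, ν⟫ := by
    by_contra! hall
    have : ∀ v ∈ AddSubmonoid.closure (ctx.base : Set V), ⟪a, v⟫ ≤ 0 := by
      intro v hv
      induction hv using AddSubmonoid.closure_induction with
      | mem x hx => exact hall x hx
      | zero => simp
      | add x y _ _ hx hy => rw [inner_add_right]; linarith
    exact absurd (this a (ctx.pos_coords a ha))
      (not_le.2 (ctx.inner_self_pos_of_mem (ctx.pos_subset ha)))
  obtain ⟨ν, hν, hpos⟩ := hex
  refine ⟨ν, hν, ?_⟩
  rcases isSubsystem_roots.sub_mem (ctx.pos_subset ha)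
    (ctx.pos_subset (ctx.base_subset hν)) hpos with h | h
  · exact absurd (h ▸ hν) hb
  · refine (ctx.pos_or_neg _ h).resolve_right fun hn => ?_
    have h1 := ctx.one_le_height hn
    have h2 := ctx.one_le_height ha
    rw [neg_sub, map_sub, ctx.height_base hν] at h1
    linarith

theorem add_pos_of_mem {a b : V} (ha : a ∈ ctx.Pos) (hb : b ∈ ctx.Pos) (h : a + b ∈ ctx.Δ) :
    a + b ∈ ctx.Pos :=
  ctx.pos_of_mem_closure h (add_mem (ctx.pos_coords a ha) (ctx.pos_coords b hb))

theorem add_ne_zero_of_pos {a b : V} (ha : a ∈ ctx.Pos) (hb : b ∈ ctx.Pos) : a + b ≠ 0 := by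
  intro h
  have h1 := congrArg ctx.height h
  rw [map_add, map_zero] at h1
  linarith [ctx.one_le_height ha, ctx.one_le_height hb]

/-- If `a`, `b`, `c`, `a + b` and `a + b + c` are positive roots, then so is `b + c` or
`a + c`. -/
theorem add_pos_or_add_pos {a b c : V} (ha : a ∈ ctx.Pos) (hb : b ∈ ctx.Pos)
    (hc : c ∈ ctx.Pos) (hab : a + b ∈ ctx.Pos) (habc : a + b + c ∈ ctx.Pos) :
    b + c ∈ ctx.Pos ∨ a + c ∈ ctx.Pos := by
  by_contra! hcon
  obtain ⟨hbc, hac⟩ := hcon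
  have hadd : ∀ {p q : V}, p ∈ ctx.Pos → q ∈ ctx.Pos → p + q ∉ ctx.Pos → 0 ≤ ⟪p, q⟫ := by
    intro p q hp hq hpq
    by_contra! hneg
    rcases isSubsystem_roots.sub_mem (ctx.pos_subset hp) (ctx.neg_mem q (ctx.pos_subset hq))
      (by rw [inner_neg_right]; linarith) with h | h
    · exact add_ne_zero_of_pos hp hq (by rw [h, neg_add_cancel])
    · rw [sub_neg_eq_add] at h
      exact hpq (add_pos_of_mem hp hq h)
  have hsub : ∀ {p q r : V}, p ∈ ctx.Pos → q ∈ ctx.Pos → r ∈ ctx.Pos → q + r ∉ ctx.Pos →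
      p + (q + r) ∈ ctx.Pos → ⟪p + (q + r), p⟫ ≤ 0 := by
    intro p q r hp hq hr hqr hs
    by_contra! hlt
    rcases isSubsystem_roots.sub_mem (ctx.pos_subset hs) (ctx.pos_subset hp) hlt with h | h
    · exact add_ne_zero_of_pos hq hr (by simpa using h)
    · rw [add_sub_cancel_left] at h
      exact hqr (add_pos_of_mem hq hr h)
  have h1 := hadd hb hc hbc
  have h2 := hadd ha hc hac
  have h3 := hsub ha hb hc hbc (by rwa [← add_assoc])
  have h4 := hsub hb ha hc hac (by rwa [← add_assoc, add_comm b a])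
  have h5 := ctx.inner_self_pos_of_mem (ctx.pos_subset hab)
  rw [← add_assoc] at h3
  rw [← add_assoc, add_comm b a] at h4
  have h6 : ⟪a + b + c, a + b⟫ ≤ 0 := by rw [inner_add_right]; linarith
  rw [inner_add_left, inner_add_right c, real_inner_comm, real_inner_comm a c,
    real_inner_comm b c] at h6
  linarith

/-- Suppose a functional takes values in `{-1, 0, 1, 2}` on positive roots and not the value `2`
on simple roots. Then a positive root of value `1` that splits with values `2` and `-1` also
splits with values `1` and `0`. -/
theorem exists_split_of_split {x : V}
    (hval : ∀ γ ∈ ctx.Pos, ⟪γ, x⟫ = -1 ∨ ⟪γ, x⟫ = 0 ∨ ⟪γ, x⟫ = 1 ∨ ⟪γ, x⟫ = 2)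
    (hbase : ∀ α ∈ ctx.base, ⟪α, x⟫ ≠ 2) (n : ℕ) {a b : V} (ha : a ∈ ctx.Pos)
    (hb : b ∈ ctx.Pos) (hab : a + b ∈ ctx.Pos) (hax : ⟪a, x⟫ = 2) (hbx : ⟪b, x⟫ = -1)
    (hn : ctx.height a ≤ n) :
    ∃ p ∈ ctx.Pos, ∃ q ∈ ctx.Pos, p + q = a + b ∧ ⟪p, x⟫ = 1 ∧ ⟪q, x⟫ = 0 := by
  induction n generalizing a b with
  | zero =>
    have := ctx.one_le_height ha
    rw [Nat.cast_zero] at hn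
    linarith
  | succ n ih =>
    obtain ⟨ν, hν, ha'⟩ := exists_sub_base_pos ha fun h => hbase a h hax
    have hνp := ctx.base_subset hν
    have hax' : ⟪a - ν, x⟫ = 2 - ⟪ν, x⟫ := by rw [inner_sub_left, hax]
    have hht : ctx.height (a - ν) ≤ n := by
      rw [map_sub, ctx.height_base hν]
      push_cast at hn
      linarith
    have hνx : ⟪ν, x⟫ = 0 ∨ ⟪ν, x⟫ = 1 := by
      rcases hval ν hνp with h | h | h | h
      · rcases hval _ ha' with h' | h' | h' | h' <;> linarith
      · exact Or.inl h
      · exact Or.inr h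
      · exact absurd h (hbase ν hν)
    rcases add_pos_or_add_pos ha' hνp hb (by rwa [sub_add_cancel])
      (by rwa [sub_add_cancel]) with h | h <;> rcases hνx with h0 | h0
    · obtain ⟨p, hp, q, hq, hpq, h'⟩ := ih ha' h
        (by convert hab using 1; abel) (by rw [hax', h0, sub_zero])
        (by rw [inner_add_left, h0, hbx, zero_add]) hht
      exact ⟨p, hp, q, hq, by rw [hpq]; abel, h'⟩
    · exact ⟨a - ν, ha', ν + b, h, by abel, by rw [hax', h0]; norm_num,
        by rw [inner_add_left, h0, hbx]; norm_num⟩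
    · exact ⟨a - ν + b, h, ν, hνp, by abel, by rw [inner_add_left, hax', h0, hbx]; norm_num, h0⟩
    · exact ⟨ν, hνp, a - ν + b, h, by abel, h0,
        by rw [inner_add_left, hax', h0, hbx]; norm_num⟩

/-- Under the hypotheses of `exists_split_of_split`, every non-simple positive root of value `1`
is the sum of positive roots of values `1` and `0`. -/
theorem exists_split {x : V}
    (hval : ∀ γ ∈ ctx.Pos, ⟪γ, x⟫ = -1 ∨ ⟪γ, x⟫ = 0 ∨ ⟪γ, x⟫ = 1 ∨ ⟪γ, x⟫ = 2)
    (hbase : ∀ α ∈ ctx.base, ⟪α, x⟫ ≠ 2) {γ : V} (hγ : γ ∈ ctx.Pos)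
    (hγb : γ ∉ ctx.base) (hγx : ⟪γ, x⟫ = 1) :
    ∃ p ∈ ctx.Pos, ∃ q ∈ ctx.Pos, p + q = γ ∧ ⟪p, x⟫ = 1 ∧ ⟪q, x⟫ = 0 := by
  obtain ⟨α, hα, h⟩ := exists_sub_base_pos hγ hγb
  have hx : ⟪γ - α, x⟫ = 1 - ⟪α, x⟫ := by rw [inner_sub_left, hγx]
  have hαp := ctx.base_subset hα
  rcases hval α hαp with h0 | h0 | h0 | h0
  · obtain ⟨n, hn⟩ := exists_nat_ge (ctx.height (γ - α))
    have := exists_split_of_split hval hbase n h hαp (by rwa [sub_add_cancel])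
      (by rw [hx, h0]; norm_num) h0 hn
    rwa [sub_add_cancel] at this
  · exact ⟨γ - α, h, α, hαp, by abel, by rw [hx, h0]; norm_num, h0⟩
  · exact ⟨α, hαp, γ - α, h, by abel, h0, by rw [hx, h0]; norm_num⟩
  · exact absurd h0 (hbase α hα)

/-- The cascade element takes only the values `-1`, `0`, `1`, `2` on positive roots, provided the
positive roots of value `1` or `2` form an inversion set. -/
theorem IsCascade.values {K : Finset V} (hK : ctx.IsCascade K) {w : V ≃ₗ[ℝ] V}
    (hwΔ : ∀ γ ∈ ctx.Δ, w γ ∈ ctx.Δ)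
    (hN : ∀ γ ∈ ctx.Pos,
      (-(w γ) ∈ ctx.Pos ↔ (⟪γ, cascElt K⟫ = 1 ∨ ⟪γ, cascElt K⟫ = 2)))
    {γ : V} (hγ : γ ∈ ctx.Pos) :
    ⟪γ, cascElt K⟫ = -1 ∨ ⟪γ, cascElt K⟫ = 0 ∨ ⟪γ, cascElt K⟫ = 1 ∨ ⟪γ, cascElt K⟫ = 2 := by
  have hpos : ∀ μ ∈ ctx.Pos, ¬(⟪μ, cascElt K⟫ = 1 ∨ ⟪μ, cascElt K⟫ = 2) → w μ ∈ ctx.Pos :=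
    fun μ hμ h => (ctx.pos_or_neg _ (hwΔ μ (ctx.pos_subset hμ))).resolve_right
      (mt (hN μ hμ).1 h)
  obtain ⟨β, hβ, rfl | h⟩ := hK.exists_sub_pos hγ
  · exact Or.inr (Or.inr (Or.inl (hK.inner_cascElt hβ)))
  by_cases h1 : ⟪γ, cascElt K⟫ = 1 ∨ ⟪γ, cascElt K⟫ = 2
  · exact Or.inr (Or.inr h1)
  have hx : ⟪β - γ, cascElt K⟫ = 1 - ⟪γ, cascElt K⟫ := by
    rw [inner_sub_left, hK.inner_cascElt hβ]
  by_cases h2 : ⟪β - γ, cascElt K⟫ = 1 ∨ ⟪β - γ, cascElt K⟫ = 2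
  · rcases h2 with h2 | h2
    · exact Or.inr (Or.inl (by linarith))
    · exact Or.inl (by linarith)
  exfalso
  have h3 := ctx.one_le_height (hpos γ hγ h1)
  have h4 := ctx.one_le_height (hpos _ h h2)
  have h5 := ctx.one_le_height ((hN β (hK.mem_pos hβ)).2 (Or.inl (hK.inner_cascElt hβ)))
  rw [map_sub, map_sub] at h4
  rw [map_neg] at h5
  linarith

end RootSystemCtx

/-- The maximal elements of the complement `Δ⁺ \\ Δ⟨K⟩` of the set of roots of the abelian
ideal `a_K` are exactly `-w_K(Π_K(1))`. -/
theorem max_of_ideal_complement {V : Type*} [NormedAddCommGroup V] [InnerProductSpace ℝ V]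
    [FiniteDimensional ℝ V] (ctx : RootSystemCtx V)
    (K : Finset V) (hK : ctx.IsCascade K)
    (hA : ¬ ∃ p, 1 ≤ p ∧ ctx.IsTypeA (2 * p))
    (w : V ≃ₗ[ℝ] V) (hw : w ∈ ctx.weylGroup)
    (hN : ∀ γ ∈ ctx.Pos,
      (-(w γ) ∈ ctx.Pos ↔ (⟪γ, cascElt K⟫ = 1 ∨ ⟪γ, cascElt K⟫ = 2))) :
    ∀ δ : V,
      (δ ∈ ctx.Pos ∧ δ ∉ ctx.idealSet w (cascElt K) ∧
        ∀ δ' ∈ ctx.Pos, δ' ∉ ctx.idealSet w (cascElt K) → ctx.rootLE δ δ' → δ' = δ) ↔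
      (∃ α ∈ ctx.base, ⟪α, cascElt K⟫ = 1 ∧ δ = -(w α)) := by
  have hwΔ := RootSystemCtx.weylGroup_map_mem hw
  have hwΔ' := RootSystemCtx.weylGroup_map_mem (inv_mem hw)
  have hval : ∀ γ ∈ ctx.Pos, ⟪γ, cascElt K⟫ = -1 ∨ ⟪γ, cascElt K⟫ = 0 ∨
      ⟪γ, cascElt K⟫ = 1 ∨ ⟪γ, cascElt K⟫ = 2 := fun γ hγ =>
    RootSystemCtx.IsCascade.values hK hwΔ hN hγ
  have hbase : ∀ α ∈ ctx.base, ⟪α, cascElt K⟫ ≠ 2 := fun α hα => hK.inner_base_ne_two hα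
  have hwpos : ∀ γ ∈ ctx.Pos, ⟪γ, cascElt K⟫ = 0 → w γ ∈ ctx.Pos := fun γ hγ h0 =>
    (ctx.pos_or_neg _ (hwΔ γ (ctx.pos_subset hγ))).resolve_right fun hn => by
      rcases (hN γ hγ).1 hn with h | h <;> rw [h0] at h <;> norm_num at h
  have hinv : ∀ δ ∈ ctx.Pos, (∃ γ ∈ ctx.Pos, δ = w γ ∧
      (⟪γ, cascElt K⟫ = -1 ∨ ⟪γ, cascElt K⟫ = 0)) ∨
      (∃ γ ∈ ctx.Pos, δ = -(w γ) ∧ (⟪γ, cascElt K⟫ = 1 ∨ ⟪γ, cascElt K⟫ = 2)) := by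
    intro δ hδ
    have hδ' : w (w⁻¹ δ) = δ := w.apply_symm_apply δ
    rcases ctx.pos_or_neg _ (hwΔ' δ (ctx.pos_subset hδ)) with h | h
    · refine Or.inl ⟨w⁻¹ δ, h, hδ'.symm, ?_⟩
      have h1 : ¬(⟪w⁻¹ δ, cascElt K⟫ = 1 ∨ ⟪w⁻¹ δ, cascElt K⟫ = 2) := by
        rw [← hN _ h, hδ']
        exact ctx.pos_not_neg δ hδ
      have := hval _ h
      tauto
    · refine Or.inr ⟨-(w⁻¹ δ), h, by rw [map_neg, neg_neg, hδ'], ?_⟩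
      rw [← hN _ h, map_neg, neg_neg, hδ']
      exact hδ
  have hcompl : ∀ γ ∈ ctx.Pos, ⟪γ, cascElt K⟫ = 1 →
      -(w γ) ∉ ctx.idealSet w (cascElt K) := by
    rintro γ hγ h1 ⟨η, hη, ⟨-, h⟩ | ⟨h2, h⟩⟩
    · rw [← map_neg] at h
      exact ctx.pos_not_neg γ hγ (w.injective h ▸ hη)
    · rw [← w.injective (neg_injective h), h1] at h2
      norm_num at h2
  have hclosure : ∀ v ∈ AddSubmonoid.closure (ctx.base : Set V),
      ⟪w⁻¹ v, cascElt K⟫ ≤ 0 ∧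
        (⟪w⁻¹ v, cascElt K⟫ = 0 → w⁻¹ v ∈ AddSubmonoid.closure (ctx.base : Set V)) := by
    intro v hv
    induction hv using AddSubmonoid.closure_induction with
    | mem μ hμ =>
      rcases hinv μ (ctx.base_subset hμ) with ⟨γ, hγ, rfl, h⟩ | ⟨γ, hγ, rfl, h⟩
      · rw [show w⁻¹ (w γ) = γ from w.symm_apply_apply γ]
        exact ⟨by rcases h with h | h <;> norm_num [h], fun _ => ctx.pos_coords γ hγ⟩
      · rw [map_neg, show w⁻¹ (w γ) = γ from w.symm_apply_apply γ, inner_neg_left]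
        rcases h with h | h <;> norm_num [h]
    | zero => simp
    | add a b _ _ ha hb =>
      rw [map_add, inner_add_left]
      exact ⟨by linarith [ha.1, hb.1], fun h =>
        add_mem (ha.2 (by linarith [ha.1, hb.1])) (hb.2 (by linarith [ha.1, hb.1]))⟩
  intro δ
  constructor
  · rintro ⟨hδ, hδi, hmax⟩
    rcases hinv δ hδ with ⟨γ, hγ, rfl, h | h⟩ | ⟨γ, hγ, rfl, h | h⟩
    · exact absurd ⟨γ, hγ, Or.inl ⟨h, rfl⟩⟩ hδi
    · exfalso
      obtain ⟨β, hβ, rfl | hpos⟩ := hK.exists_sub_pos hγ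
      · rw [hK.inner_cascElt hβ] at h
        norm_num at h
      have h1 : ⟪β - γ, cascElt K⟫ = 1 := by
        rw [inner_sub_left, hK.inner_cascElt hβ, h, sub_zero]
      have hβw := (hN β (hK.mem_pos hβ)).2 (Or.inl (hK.inner_cascElt hβ))
      have heq : -(w (β - γ)) - w γ = -(w β) := by rw [map_sub]; abel
      have := hmax _ ((hN _ hpos).2 (Or.inl h1)) (hcompl _ hpos h1)
        (by rw [RootSystemCtx.rootLE, heq]; exact ctx.pos_coords _ hβw)
      rw [this, sub_self] at heq
      exact ctx.ne_zero_of_mem (ctx.pos_subset hβw) heq.symm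
    · refine ⟨γ, ?_, h, rfl⟩
      by_contra hγb
      obtain ⟨p, hp, q, hq, rfl, hpx, hqx⟩ :=
        RootSystemCtx.exists_split hval hbase hγ hγb h
      have hqw := hwpos q hq hqx
      have heq : -(w p) - -(w (p + q)) = w q := by rw [map_add]; abel
      have := hmax _ ((hN p hp).2 (Or.inl hpx)) (hcompl p hp hpx)
        (by rw [RootSystemCtx.rootLE, heq]; exact ctx.pos_coords _ hqw)
      rw [this, sub_self] at heq
      exact ctx.ne_zero_of_mem (ctx.pos_subset hqw) heq.symm
    · exact absurd ⟨γ, hγ, Or.inr ⟨h, rfl⟩⟩ hδi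
  · rintro ⟨α, hα, hαx, rfl⟩
    have hαp := ctx.base_subset hα
    refine ⟨(hN α hαp).2 (Or.inl hαx), hcompl α hαp hαx, fun δ' hδ' hδ'i hle => ?_⟩
    obtain ⟨hz, hz0⟩ := hclosure _ hle
    have hwα : w⁻¹ (w α) = α := w.symm_apply_apply α
    rw [map_sub, map_neg, hwα] at hz hz0
    rcases hinv δ' hδ' with ⟨γ, hγ, rfl, h⟩ | ⟨γ, hγ, rfl, h | h⟩
    · rw [show w⁻¹ (w γ) = γ from w.symm_apply_apply γ, inner_sub_left, inner_neg_left,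
        hαx] at hz
      rcases h with h | h
      · exact absurd ⟨γ, hγ, Or.inl ⟨h, rfl⟩⟩ hδ'i
      · rw [h] at hz
        norm_num at hz
    · rw [map_neg, show w⁻¹ (w γ) = γ from w.symm_apply_apply γ] at hz0
      have hmem := hz0 (by
        rw [inner_sub_left, inner_neg_left, inner_neg_left, hαx, h, sub_self])
      have h0 := ctx.eq_zero_of_height_le hmem (by
        rw [map_sub, map_neg, map_neg, ctx.height_base hα]
        linarith [ctx.one_le_height hγ])
      rw [neg_injective (sub_eq_zero.1 h0)]
    · exact absurd ⟨γ, hγ, Or.inr ⟨h, rfl⟩⟩ hδ'i
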